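/- arXiv:math/0512502 — 2 statements merged into one kernel-verified Lean document; each statement's English description precedes it below -/
import Mathlib

section
/- Suppose κ_min := inf(supp ρ) > 0. Then for every collection of real numbers (v_b)_{b∈B_L} ∈ ℝ^{B_L}, ∫ exp( ∑_{b∈B_L} v_b η_b ) P_L(dη) ≤ exp( (2κ_min)^{-1} ∑_{b∈B_L} v_b² ). -/
open MeasureTheory Real Filter
open scoped ENNReal

noncomputable section

abbrev Torus (L : ℕ) := ZMod L × ZMod L
abbrev Edge (L : ℕ) := Torus L × Bool
def estep (L : ℕ) (d : Bool) : Torus L := if d then (1, 0) else (0, 1)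
def etarget {L : ℕ} (e : Edge L) : Torus L := e.1 + estep L e.2
def grad {L : ℕ} (φ : Torus L → ℝ) : Edge L → ℝ := fun e => φ (etarget e) - φ e.1

def nuL (L : ℕ) [NeZero L] : Measure (Edge L → ℝ) :=
  Measure.map (fun φ : Torus L → ℝ => grad φ)
    (Measure.map
      (fun ψ : {x : Torus L // x ≠ 0} → ℝ => fun x : Torus L =>
        if h : x = 0 then (0 : ℝ) else ψ ⟨x, h⟩)
      volume)

def energy (L : ℕ) [NeZero L] (κ η : Edge L → ℝ) : ℝ :=
  (1 / 2) * ∑ b : Edge L, κ b * η b ^ 2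

def ZL (L : ℕ) [NeZero L] (κ : Edge L → ℝ) : ℝ≥0∞ :=
  ∫⁻ η, ENNReal.ofReal (Real.exp (-(energy L κ η))) ∂(nuL L)

/-- Product a priori measure on the `κ`'s. -/
def rhoL (L : ℕ) [NeZero L] (ρ : Measure ℝ) : Measure (Edge L → ℝ) :=
  Measure.pi fun _ : Edge L => ρ

/-- Partition function of the extended model. -/
def ZLV (L : ℕ) [NeZero L] (ρ : Measure ℝ) : ℝ≥0∞ :=
  ∫⁻ x : (Edge L → ℝ) × (Edge L → ℝ),
    ENNReal.ofReal (Real.exp (-(energy L x.2 x.1))) ∂((nuL L).prod (rhoL L ρ))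

/-- The extended gradient Gibbs measure `Q_L` on pairs `(η, κ)`. -/
def QL (L : ℕ) [NeZero L] (ρ : Measure ℝ) : Measure ((Edge L → ℝ) × (Edge L → ℝ)) :=
  (ZLV L ρ)⁻¹ •
    (((nuL L).prod (rhoL L ρ)).withDensity fun x =>
      ENNReal.ofReal (Real.exp (-(energy L x.2 x.1))))

/-- The `η`-marginal `P_L` of `Q_L`. -/
def PL (L : ℕ) [NeZero L] (ρ : Measure ℝ) : Measure (Edge L → ℝ) :=
  (QL L ρ).map Prod.fst

/-- Topological support of a measure on `ℝ`. -/
def measSupport (ρ : Measure ℝ) : Set ℝ := {x | ∀ U ∈ nhds x, 0 < ρ U}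

/-- The topological support of a measure on `ℝ` carries the whole measure. -/
theorem ae_mem_measSupport (ρ : Measure ℝ) : ∀ᵐ x ∂ρ, x ∈ measSupport ρ := by
  refine measure_null_of_locally_null _ fun x hx => ?_
  have hx' : ¬ ∀ U ∈ nhds x, 0 < ρ U := hx
  push Not at hx'
  obtain ⟨U, hU, h0⟩ := hx'
  exact ⟨U, mem_nhdsWithin_of_mem_nhds hU, le_antisymm h0 (zero_le)⟩

theorem ae_sInf_measSupport_le {ρ : Measure ℝ} (hρ : ρ (Set.Iic 0) = 0) :
    ∀ᵐ x ∂ρ, sInf (measSupport ρ) ≤ x := by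
  have hbdd : BddBelow (measSupport ρ) := by
    refine ⟨0, fun x hx => ?_⟩
    by_contra! h
    exact (hx _ (Iic_mem_nhds h)).ne' hρ
  filter_upwards [ae_mem_measSupport ρ] with x hx using csInf_le hbdd hx

theorem ae_forall_sInf_measSupport_le (L : ℕ) [NeZero L] {ρ : Measure ℝ}
    [IsProbabilityMeasure ρ] (hρ : ρ (Set.Iic 0) = 0) :
    ∀ᵐ κ ∂(rhoL L ρ), ∀ b, sInf (measSupport ρ) ≤ κ b :=
  ae_all_iff.2 fun b =>
    (measurePreserving_eval (fun _ : Edge L => ρ) b).quasiMeasurePreserving.ae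
      (ae_sInf_measSupport_le hρ)

/-- A linear functional on the range of `A` induced by `v` is represented by a vector of the
range in the weighted inner product with weights `κ`. -/
theorem exists_weighted_riesz {V E : Type*} [AddCommGroup V] [Module ℝ V] [Fintype E]
    (A : V →ₗ[ℝ] E → ℝ) {κ : E → ℝ} (hκ : ∀ b, 0 < κ b) (v : E → ℝ) :
    ∃ ψ₀ : V, ∀ ψ : V, ∑ b, κ b * A ψ₀ b * A ψ b = ∑ b, v b * A ψ b := by
  let D : (E → ℝ) →ₗ[ℝ] E → ℝ :=
    { toFun := fun η b => √(κ b) * η b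
      map_add' := fun x y => by ext b; simp [mul_add]
      map_smul' := fun c x => by ext b; simp [mul_left_comm] }
  let T : V →ₗ[ℝ] EuclideanSpace ℝ E :=
    (WithLp.linearEquiv 2 ℝ (E → ℝ)).symm.toLinearMap ∘ₗ D ∘ₗ A
  let u : EuclideanSpace ℝ E := WithLp.toLp 2 fun b => v b / √(κ b)
  obtain ⟨ψ₀, hψ₀⟩ : (T.range.starProjection u) ∈ T.range :=
    Submodule.starProjection_apply_mem _ _
  refine ⟨ψ₀, fun ψ => ?_⟩
  have h := Submodule.starProjection_inner_eq_zero (K := T.range) u (T ψ) ⟨ψ, rfl⟩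
  rw [← hψ₀, inner_sub_left, sub_eq_zero, PiLp.inner_apply, PiLp.inner_apply] at h
  refine Eq.trans (Finset.sum_congr rfl fun b _ => ?_)
    (h.symm.trans (Finset.sum_congr rfl fun b _ => ?_))
  · change _ = (√(κ b) * A ψ b) * (√(κ b) * A ψ₀ b)
    linear_combination (-(A ψ b * A ψ₀ b)) * Real.mul_self_sqrt (hκ b).le
  · change (√(κ b) * A ψ b) * (v b / √(κ b)) = _
    have := (Real.sqrt_pos.2 (hκ b)).ne'
    field_simp

/-- Tilting a centered Gaussian density on the range of a linear map by a linear functional costs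
at most the exponential of half the dual weighted norm of the functional. -/
theorem lintegral_tilted_gaussian_le {ι E : Type*} [Fintype ι] [Fintype E]
    (A : (ι → ℝ) →ₗ[ℝ] E → ℝ) {m : ℝ} (hm : 0 < m) {κ : E → ℝ} (hκ : ∀ b, m ≤ κ b)
    (v : E → ℝ) :
    ∫⁻ ψ, ENNReal.ofReal (exp (-(1 / 2 * ∑ b, κ b * A ψ b ^ 2))) *
        ENNReal.ofReal (exp (∑ b, v b * A ψ b)) ≤
      ENNReal.ofReal (exp ((2 * m)⁻¹ * ∑ b, v b ^ 2)) *
        ∫⁻ ψ, ENNReal.ofReal (exp (-(1 / 2 * ∑ b, κ b * A ψ b ^ 2))) := by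
  have hκ0 : ∀ b, 0 < κ b := fun b => hm.trans_le (hκ b)
  obtain ⟨ψ₀, h⟩ := exists_weighted_riesz A hκ0 v
  have hcost : 1 / 2 * ∑ b, κ b * A ψ₀ b ^ 2 ≤ (2 * m)⁻¹ * ∑ b, v b ^ 2 := by
    have h₀ := h ψ₀
    have hle : ∑ b, (2 * (v b * A ψ₀ b) - κ b * A ψ₀ b * A ψ₀ b) ≤ ∑ b, m⁻¹ * v b ^ 2 := by
      refine Finset.sum_le_sum fun b _ => ?_
      have h1 : v b ^ 2 = m * (m⁻¹ * v b ^ 2) := by field_simp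
      have h2 : m * (m⁻¹ * v b - A ψ₀ b) ^ 2 =
          m⁻¹ * v b ^ 2 - 2 * (v b * A ψ₀ b) + m * A ψ₀ b ^ 2 := by field_simp; ring
      have h3 : 0 ≤ m * (m⁻¹ * v b - A ψ₀ b) ^ 2 := by positivity
      have h4 := mul_le_mul_of_nonneg_right (hκ b) (sq_nonneg (A ψ₀ b))
      linarith [pow_two (A ψ₀ b), mul_assoc (κ b) (A ψ₀ b) (A ψ₀ b)]
    rw [Finset.sum_sub_distrib, ← Finset.mul_sum, ← Finset.mul_sum, ← h₀] at hle
    have hsq : ∑ b, κ b * A ψ₀ b ^ 2 = ∑ b, κ b * A ψ₀ b * A ψ₀ b :=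
      Finset.sum_congr rfl fun b _ => by ring
    rw [hsq, mul_inv]
    linarith
  have hsquare : ∀ ψ, -(1 / 2 * ∑ b, κ b * A ψ b ^ 2) + ∑ b, v b * A ψ b =
      1 / 2 * ∑ b, κ b * A ψ₀ b ^ 2 + -(1 / 2 * ∑ b, κ b * A (ψ - ψ₀) b ^ 2) := by
    intro ψ
    have hexp : ∑ b, κ b * A (ψ - ψ₀) b ^ 2 = ∑ b, κ b * A ψ b ^ 2 -
        2 * ∑ b, κ b * A ψ₀ b * A ψ b + ∑ b, κ b * A ψ₀ b ^ 2 := by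
      rw [Finset.mul_sum, ← Finset.sum_sub_distrib, ← Finset.sum_add_distrib]
      refine Finset.sum_congr rfl fun b _ => ?_
      rw [map_sub, Pi.sub_apply]
      ring
    rw [hexp, h ψ]
    ring
  simp_rw [← ENNReal.ofReal_mul (exp_nonneg _), ← exp_add, hsquare, exp_add,
    ENNReal.ofReal_mul (exp_nonneg _)]
  rw [lintegral_const_mul' _ _ ENNReal.ofReal_ne_top,
    lintegral_sub_right_eq_self
      (fun ψ => ENNReal.ofReal (exp (-(1 / 2 * ∑ b, κ b * A ψ b ^ 2)))) ψ₀]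
  gcongr

/-- The gradient of the extension by zero of a field on the torus minus the origin. -/
def gradExtend (L : ℕ) : ({x : Torus L // x ≠ 0} → ℝ) →ₗ[ℝ] Edge L → ℝ where
  toFun ψ := grad fun x : Torus L => if h : x = 0 then (0 : ℝ) else ψ ⟨x, h⟩
  map_add' ψ χ := by
    ext e
    simp only [grad, Pi.add_apply]
    split_ifs <;> ring
  map_smul' c ψ := by
    ext e
    simp only [grad, Pi.smul_apply, smul_eq_mul, RingHom.id_apply]
    split_ifs <;> ring

theorem nuL_eq_map_gradExtend (L : ℕ) [NeZero L] :
    nuL L = Measure.map (gradExtend L) volume := by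
  rw [nuL, Measure.map_map]
  · rfl
  · unfold grad
    fun_prop
  · refine measurable_pi_lambda _ fun x => ?_
    split_ifs <;> fun_prop

theorem measurable_gradExtend (L : ℕ) [NeZero L] : Measurable (gradExtend L) :=
  (gradExtend L).continuous_of_finiteDimensional.measurable

instance (L : ℕ) [NeZero L] : SFinite (nuL L) := by
  unfold nuL
  infer_instance

instance (L : ℕ) [NeZero L] (ρ : Measure ℝ) [IsProbabilityMeasure ρ] :
    IsProbabilityMeasure (rhoL L ρ) := by
  unfold rhoL
  infer_instance

theorem lintegral_nuL_tilted_le (L : ℕ) [NeZero L] {m : ℝ} (hm : 0 < m) {κ : Edge L → ℝ}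
    (hκ : ∀ b, m ≤ κ b) (v : Edge L → ℝ) :
    ∫⁻ η, ENNReal.ofReal (exp (-(energy L κ η))) *
        ENNReal.ofReal (exp (∑ b, v b * η b)) ∂(nuL L) ≤
      ENNReal.ofReal (exp ((2 * m)⁻¹ * ∑ b, v b ^ 2)) *
        ∫⁻ η, ENNReal.ofReal (exp (-(energy L κ η))) ∂(nuL L) := by
  unfold energy
  rw [nuL_eq_map_gradExtend, lintegral_map (by fun_prop) (measurable_gradExtend L),
    lintegral_map (by fun_prop) (measurable_gradExtend L)]
  exact lintegral_tilted_gaussian_le (gradExtend L) hm hκ v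

theorem lintegral_exp_PL_le (L : ℕ) [NeZero L] (ρ : Measure ℝ) [IsProbabilityMeasure ρ]
    (hρ : ρ (Set.Iic 0) = 0) (hpos : 0 < sInf (measSupport ρ)) (v : Edge L → ℝ) :
    ∫⁻ η, ENNReal.ofReal (exp (∑ b, v b * η b)) ∂(PL L ρ) ≤
      ENNReal.ofReal (exp ((2 * sInf (measSupport ρ))⁻¹ * ∑ b, v b ^ 2)) := by
  set C := ENNReal.ofReal (exp ((2 * sInf (measSupport ρ))⁻¹ * ∑ b, v b ^ 2))
  have hmeas : Measurable fun x : (Edge L → ℝ) × (Edge L → ℝ) =>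
      ENNReal.ofReal (exp (-(energy L x.2 x.1))) := by
    unfold energy
    fun_prop
  have hmeas' : Measurable fun x : (Edge L → ℝ) × (Edge L → ℝ) =>
      ENNReal.ofReal (exp (-(energy L x.2 x.1))) *
        ENNReal.ofReal (exp (∑ b, v b * x.1 b)) := hmeas.mul (by fun_prop)
  have hle : ∫⁻ x : (Edge L → ℝ) × (Edge L → ℝ), ENNReal.ofReal (exp (-(energy L x.2 x.1))) *
      ENNReal.ofReal (exp (∑ b, v b * x.1 b)) ∂((nuL L).prod (rhoL L ρ)) ≤ C * ZLV L ρ := by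
    rw [ZLV, lintegral_prod_symm' _ hmeas, lintegral_prod_symm' _ hmeas',
      ← lintegral_const_mul' _ _ ENNReal.ofReal_ne_top]
    refine lintegral_mono_ae ?_
    filter_upwards [ae_forall_sInf_measSupport_le L hρ] with κ hκ
    exact lintegral_nuL_tilted_le L hpos hκ v
  rw [PL, lintegral_map (by fun_prop) measurable_fst, QL, lintegral_smul_measure,
    lintegral_withDensity_eq_lintegral_mul _ hmeas (by fun_prop), smul_eq_mul]
  calc _ ≤ (ZLV L ρ)⁻¹ * (C * ZLV L ρ) := mul_le_mul_right hle _
    _ = C * ((ZLV L ρ)⁻¹ * ZLV L ρ) := by ring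
    _ ≤ C * 1 := mul_le_mul_right (ENNReal.inv_mul_le_one _) _
    _ = C := mul_one C

/-- Gaussian bound on the exponential moments of the gradient
field under the `η`-marginal `P_L`, with `κ_min = inf (supp ρ) > 0`. -/
theorem exp_moment_bound (L : ℕ) [NeZero L] (hL : Even L) (hL0 : 0 < L)
    (ρ : Measure ℝ) [IsProbabilityMeasure ρ] (hρ : ρ (Set.Iic 0) = 0)
    (κmin : ℝ) (hκmin : κmin = sInf (measSupport ρ)) (hκpos : 0 < κmin)
    (v : Edge L → ℝ) :
    ∫ η, Real.exp (∑ b : Edge L, v b * η b) ∂(PL L ρ) ≤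
      Real.exp ((2 * κmin)⁻¹ * ∑ b : Edge L, v b ^ 2) := by
  subst hκmin
  rw [integral_eq_lintegral_of_nonneg_ae (ae_of_all _ fun _ => exp_nonneg _)
    (Measurable.aestronglyMeasurable (by fun_prop))]
  exact ENNReal.toReal_le_of_le_ofReal (exp_nonneg _) (lintegral_exp_PL_le L ρ hρ hκpos v)

end
end

section
/- Let (κ_b)_{b∈B_L} be strictly positive weights and define the dual weights (κ*_b)_{b∈B_L} by κ*_{(x−e₂, x)} := 1/κ_{(x, x+e₁)} and κ*_{(x−e₁, x)} := 1/κ_{(x, x+e₂)} for every x ∈ T_L (here (x−e₂, x) is a vertical edge and (x−e₁, x) is a horizontal edge; this is the assignment κ*_{b*} = 1/κ_b where b* is the edge of the dual torus crossing b, with the dual vertex x+(1/2,1/2) identified with x). Then Z*_{L,(κ*_b)} = 2π L² · ( ∏_{b∈B_L} κ_b^{1/2} ) · Z_{L,(κ_b)}. -/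
open MeasureTheory Real Filter
open scoped ENNReal

noncomputable section

/-- The a priori measure `ν*_L`: pushforward of `ν_L ⊗ Leb(ℝ²)` under
`(ζ,(s,t)) ↦ η` with `η_b = ζ_b + s/L²` (horizontal `b`) or `ζ_b + t/L²`
(vertical `b`). -/
def nuStar (L : ℕ) [NeZero L] : Measure (Edge L → ℝ) :=
  Measure.map
    (fun q : (Edge L → ℝ) × (ℝ × ℝ) => fun b : Edge L =>
      q.1 b + (if b.2 then q.2.1 else q.2.2) / (L : ℝ) ^ 2)
    ((nuL L).prod volume)

/-- The partition function `Z*_{L,(κ_b)}`. -/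
def ZLstar (L : ℕ) [NeZero L] (κ : Edge L → ℝ) : ℝ≥0∞ :=
  ∫⁻ η, ENNReal.ofReal (Real.exp (-(energy L κ η))) ∂(nuStar L)

/-- The dual weights: `κ*_{b*} = 1/κ_b` where `b*` is the dual edge crossing
`b` (dual vertices identified with direct ones via `x + (1/2,1/2) ↔ x`):
`κ*_{(x−e₂,x)} = 1/κ_{(x,x+e₁)}` and `κ*_{(x−e₁,x)} = 1/κ_{(x,x+e₂)}`. -/
def dualWeights (L : ℕ) [NeZero L] (κ : Edge L → ℝ) : Edge L → ℝ := fun e =>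
  if e.2 then 1 / κ (e.1 + (1, 0), false) else 1 / κ (e.1 + (0, 1), true)


section LinearAlgebra

open Matrix

variable {m p q ι : Type*} [Fintype m] [DecidableEq m] [Fintype p] [DecidableEq p]
  [Fintype q] [DecidableEq q] [Fintype ι]

theorem dotProduct_transpose_mul_diagonal_mul_mulVec (w : m → ℝ) (A : Matrix m ι ℝ) (x : ι → ℝ) :
    x ⬝ᵥ ((Aᵀ * diagonal w * A) *ᵥ x) = ∑ b, w b * (A *ᵥ x) b ^ 2 := by
  rw [← mulVec_mulVec, ← mulVec_mulVec, dotProduct_mulVec, vecMul_transpose, dotProduct]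
  refine Finset.sum_congr rfl fun b _ => ?_
  rw [mulVec_diagonal]
  ring

theorem posDef_transpose_mul_diagonal_mul {w : m → ℝ} (hw : ∀ b, 0 < w b) {A : Matrix m ι ℝ}
    (hA : Function.Injective A.mulVec) : (Aᵀ * diagonal w * A).PosDef := by
  simpa [conjTranspose_eq_transpose_of_trivial] using
    (PosDef.diagonal hw).conjTranspose_mul_mul_same hA

theorem lintegral_exp_neg_half_sum_sq :
    ∫⁻ x : ι → ℝ, ENNReal.ofReal (exp (-(1 / 2 * ∑ i, x i ^ 2))) =
      ENNReal.ofReal (√(2 * π) ^ Fintype.card ι) := by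
  have hprod : ∀ x : ι → ℝ, exp (-(1 / 2 * ∑ i, x i ^ 2)) = ∏ i, exp (-(1 / 2) * x i ^ 2) := by
    intro x
    rw [← exp_sum, ← Finset.mul_sum]
    ring_nf
  simp_rw [hprod]
  rw [← ofReal_integral_eq_lintegral_ofReal]
  · rw [integral_fintype_prod_volume_eq_pow (fun y : ℝ => exp (-(1 / 2) * y ^ 2)),
      integral_gaussian]
    congr 3
    ring
  · exact Integrable.fintype_prod (μ := fun _ : ι => (volume : Measure ℝ))
      (f := fun _ y => exp (-(1 / 2) * y ^ 2))
      fun _ => integrable_exp_neg_mul_sq (by norm_num)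
  · exact Eventually.of_forall fun x => by positivity

open scoped MatrixOrder in
/-- The Gaussian integral of a positive definite weighted sum of squares of linear forms. -/
theorem lintegral_exp_neg_half_sum_mul_mulVec_sq [DecidableEq ι] (w : m → ℝ) (A : Matrix m ι ℝ)
    (hS : (Aᵀ * diagonal w * A).PosDef) :
    ∫⁻ x : ι → ℝ, ENNReal.ofReal (exp (-(1 / 2 * ∑ b, w b * (A *ᵥ x) b ^ 2))) =
      ENNReal.ofReal (√(2 * π) ^ Fintype.card ι / √(Aᵀ * diagonal w * A).det) := by
  obtain ⟨P, hP⟩ := CStarAlgebra.nonneg_iff_eq_star_mul_self.mp hS.posSemidef.nonneg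
  have hPt : star P = Pᵀ := by
    rw [star_eq_conjTranspose, conjTranspose_eq_transpose_of_trivial]
  rw [hPt] at hP
  have hdet : (Aᵀ * diagonal w * A).det = P.det ^ 2 := by
    rw [hP, det_mul, det_transpose, sq]
  have hP0 : P.det ≠ 0 := by
    intro h
    have := hS.det_pos
    simp [hdet, h] at this
  have hquad : ∀ x : ι → ℝ, ∑ b, w b * (A *ᵥ x) b ^ 2 = ∑ i, (toLin' P x) i ^ 2 := by
    intro x
    have h := dotProduct_transpose_mul_diagonal_mul_mulVec (fun _ => 1) P x
    rw [← dotProduct_transpose_mul_diagonal_mul_mulVec, hP]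
    simpa using h
  simp_rw [hquad]
  rw [← lintegral_map (μ := volume) (g := toLin' P)
      (f := fun y : ι → ℝ => ENNReal.ofReal (exp (-(1 / 2 * ∑ i, y i ^ 2)))) (by fun_prop)
      (toLin' P).continuous_of_finiteDimensional.measurable,
    Real.map_matrix_volume_pi_eq_smul_volume_pi hP0, lintegral_smul_measure,
    lintegral_exp_neg_half_sum_sq, smul_eq_mul, ← ENNReal.ofReal_mul (abs_nonneg _), hdet,
    sqrt_sq_eq_abs, abs_inv, div_eq_inv_mul]

/-- Jacobi's complementary minor identity for a weighted Gram determinant, in the form that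
compares a space of columns with its orthogonal complement. -/
theorem prod_mul_det_gram_of_orthogonal {A : Matrix m p ℝ} {C : Matrix m q ℝ} (e : m ≃ p ⊕ q)
    (hCA : Cᵀ * A = 0) {w : m → ℝ} (hw : ∀ b, w b ≠ 0) :
    (∏ b, w b) * (Aᵀ * A).det * (Cᵀ * diagonal (fun b => (w b)⁻¹) * C).det =
      (Aᵀ * diagonal w * A).det * (Cᵀ * C).det := by
  have hAC : Aᵀ * C = 0 := by simpa using congrArg transpose hCA
  have hww : diagonal w * diagonal (fun b => (w b)⁻¹) = 1 := by
    rw [diagonal_mul_diagonal, ← diagonal_one]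
    congr 1
    ext b
    exact mul_inv_cancel₀ (hw b)
  set M : Matrix m (p ⊕ q) ℝ := fromCols A C
  set N : Matrix m (p ⊕ q) ℝ := fromCols A (diagonal (fun b => (w b)⁻¹) * C)
  have h1 : Mᵀ * N = fromBlocks (Aᵀ * A) (Aᵀ * (diagonal (fun b => (w b)⁻¹) * C)) 0
      (Cᵀ * diagonal (fun b => (w b)⁻¹) * C) := by
    simp only [M, N, transpose_fromCols, fromRows_mul_fromCols, hCA, Matrix.mul_assoc]
  have h2 : Mᵀ * diagonal w * N = fromBlocks (Aᵀ * diagonal w * A) 0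
      (Cᵀ * diagonal w * A) (Cᵀ * C) := by
    have h3 : ∀ X : Matrix m q ℝ, diagonal w * (diagonal (fun b => (w b)⁻¹) * X) = X := by
      intro X
      rw [← Matrix.mul_assoc, hww, Matrix.one_mul]
    rw [Matrix.mul_assoc, mul_fromCols, h3, transpose_fromCols, fromRows_mul_fromCols, hAC,
      Matrix.mul_assoc, Matrix.mul_assoc]
  have d1 : (Mᵀ * N).det = (M.submatrix id e).det * (N.submatrix id e).det := by
    rw [← det_transpose (M.submatrix id e), ← det_mul, ← det_submatrix_equiv_self e]
    rfl
  have d2 : (Mᵀ * diagonal w * N).det =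
      (M.submatrix id e).det * (∏ b, w b) * (N.submatrix id e).det := by
    rw [← det_transpose (M.submatrix id e), ← det_diagonal, ← det_mul, ← det_mul,
      ← det_submatrix_equiv_self e]
    rfl
  rw [h1, det_fromBlocks_zero₂₁] at d1
  rw [h2, det_fromBlocks_zero₁₂] at d2
  rw [d2, mul_assoc, d1]
  ring

end LinearAlgebra

section Lattice

open Matrix

variable {L : ℕ} [NeZero L]

theorem grad_eq_zero_imp_eq {φ : Torus L → ℝ} (h : grad φ = 0) (x : Torus L) : φ x = φ 0 := by
  have hh : ∀ y : Torus L, φ (y + (1, 0)) = φ y := fun y => by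
    simpa [grad, etarget, estep, sub_eq_zero] using congrFun h (y, true)
  have hv : ∀ y : Torus L, φ (y + (0, 1)) = φ y := fun y => by
    simpa [grad, etarget, estep, sub_eq_zero] using congrFun h (y, false)
  have hn : ∀ n k : ℕ, φ ((n : ZMod L), (k : ZMod L)) = φ 0 := by
    intro n k
    induction n with
    | zero =>
      induction k with
      | zero => simp [← Prod.zero_eq_mk]
      | succ k ih => rw [← ih]; simpa using hv (((0 : ℕ) : ZMod L), (k : ZMod L))
    | succ n ih => rw [← ih]; simpa using hh ((n : ZMod L), (k : ZMod L))
  obtain ⟨a, b⟩ := x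
  simpa using hn a.val b.val

/-- Extension of a function by the value `0` at the origin. -/
def zeroExtend (L : ℕ) : ({x : Torus L // x ≠ 0} → ℝ) →ₗ[ℝ] (Torus L → ℝ) where
  toFun ψ := fun x => if h : x = 0 then (0 : ℝ) else ψ ⟨x, h⟩
  map_add' ψ χ := by ext x; by_cases h : x = 0 <;> simp [h]
  map_smul' c ψ := by ext x; by_cases h : x = 0 <;> simp [h]

/-- The discrete gradient as a linear map. -/
def gradLinear (L : ℕ) : (Torus L → ℝ) →ₗ[ℝ] (Edge L → ℝ) where
  toFun := grad
  map_add' φ ψ := by ext e; simp [grad]; ring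
  map_smul' c φ := by ext e; simp [grad]; ring

/-- The discrete gradient on functions vanishing at the origin. -/
def gradMatrix (L : ℕ) [NeZero L] : Matrix (Edge L) {x : Torus L // x ≠ 0} ℝ :=
  LinearMap.toMatrix' (gradLinear L ∘ₗ zeroExtend L)

theorem gradMatrix_mulVec (ψ : {x : Torus L // x ≠ 0} → ℝ) :
    gradMatrix L *ᵥ ψ = grad (zeroExtend L ψ) := by
  rw [gradMatrix, LinearMap.toMatrix'_mulVec]
  rfl

theorem gradMatrix_apply (b : Edge L) (j : {x : Torus L // x ≠ 0}) :
    gradMatrix L b j = grad (zeroExtend L (Pi.single j 1)) b := by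
  rw [← gradMatrix_mulVec, mulVec_single_one]
  rfl

theorem gradMatrix_mulVec_injective : Function.Injective (gradMatrix L).mulVec := by
  have hker : ∀ ψ, gradMatrix L *ᵥ ψ = 0 → ψ = 0 := by
    intro ψ hψ
    rw [gradMatrix_mulVec] at hψ
    ext ⟨x, hx⟩
    simpa [zeroExtend, hx] using grad_eq_zero_imp_eq hψ x
  intro ψ χ h
  rw [← sub_eq_zero]
  apply hker
  rw [mulVec_sub, sub_eq_zero]
  exact h

/-- The two constant fields along the coordinate directions, normalized by `L²`. -/
def harmonicMatrix (L : ℕ) : Matrix (Edge L) (Fin 2) ℝ :=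
  Matrix.of fun b => if b.2 then ![((L : ℝ) ^ 2)⁻¹, 0] else ![0, ((L : ℝ) ^ 2)⁻¹]

/-- The gradients together with the harmonic fields. -/
def extendedMatrix (L : ℕ) [NeZero L] :
    Matrix (Edge L) ({x : Torus L // x ≠ 0} ⊕ Fin 2) ℝ :=
  fromCols (gradMatrix L) (harmonicMatrix L)

theorem sum_edge (f : Edge L → ℝ) :
    ∑ b, f b = ∑ x : Torus L, f (x, true) + ∑ x : Torus L, f (x, false) := by
  rw [Fintype.sum_prod_type_right, Fintype.sum_bool]

theorem sum_grad_eq_zero (φ : Torus L → ℝ) (d : Bool) : ∑ x : Torus L, grad φ (x, d) = 0 := by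
  simp only [grad, etarget, Finset.sum_sub_distrib]
  rw [sub_eq_zero]
  exact Equiv.sum_comp (Equiv.addRight (estep L d)) φ

theorem sum_grad_curl_eq_zero (φ ψ : Torus L → ℝ) :
    ∑ x : Torus L, (grad ψ (x - (0, 1), false) * grad φ (x, true) -
      grad ψ (x - (1, 0), true) * grad φ (x, false)) = 0 := by
  have h1 := Equiv.sum_comp (Equiv.addRight ((0, 1) : Torus L))
    (fun x => ψ (x - (0, 1)) * (φ (x + (1, 0)) - φ x))
  have h2 := Equiv.sum_comp (Equiv.addRight ((1, 0) : Torus L))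
    (fun x => ψ (x - (1, 0)) * (φ (x + (0, 1)) - φ x))
  simp only [Equiv.coe_addRight, add_sub_cancel_right] at h1 h2
  have h3 : ∀ x : Torus L, x + (0, 1) + (1, 0) = x + (1, 0) + (0, 1) := fun x => by abel
  simp only [grad, etarget, estep, sub_mul, Finset.sum_sub_distrib, if_true, if_false,
    sub_add_cancel, Bool.false_eq_true]
  rw [← h1, ← h2]
  simp only [h3, ← Finset.sum_sub_distrib]
  refine Finset.sum_eq_zero fun x _ => ?_
  ring

theorem transpose_harmonicMatrix_mul_gradMatrix :
    (harmonicMatrix L)ᵀ * gradMatrix L = 0 := by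
  ext i j
  simp only [Matrix.mul_apply, transpose_apply, gradMatrix_apply, sum_edge, Matrix.zero_apply, harmonicMatrix, of_apply, if_true, if_false, Bool.false_eq_true,
    ← Finset.mul_sum, sum_grad_eq_zero, mul_zero, add_zero]

theorem transpose_harmonicMatrix_mul_self :
    (harmonicMatrix L)ᵀ * harmonicMatrix L = diagonal (fun _ => ((L : ℝ) ^ 2)⁻¹) := by
  have hL : (L : ℝ) ≠ 0 := NeZero.ne _
  ext i j
  simp only [Matrix.mul_apply, transpose_apply, sum_edge]
  fin_cases i <;> fin_cases j <;> simp [harmonicMatrix, ZMod.card] <;> field_simp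

theorem det_transpose_extendedMatrix_mul_self :
    ((extendedMatrix L)ᵀ * extendedMatrix L).det =
      ((gradMatrix L)ᵀ * gradMatrix L).det * (((L : ℝ) ^ 2)⁻¹) ^ 2 := by
  rw [extendedMatrix, transpose_fromCols, fromRows_mul_fromCols,
    transpose_harmonicMatrix_mul_gradMatrix, det_fromBlocks_zero₂₁,
    transpose_harmonicMatrix_mul_self, det_diagonal]
  simp

theorem det_transpose_gradMatrix_mul_self_pos : 0 < ((gradMatrix L)ᵀ * gradMatrix L).det := by
  simpa using (posDef_transpose_mul_diagonal_mul (w := fun _ => 1) (fun _ => one_pos)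
    (gradMatrix_mulVec_injective (L := L))).det_pos

theorem extendedMatrix_mulVec_injective : Function.Injective (extendedMatrix L).mulVec := by
  have hL : (L : ℝ) ≠ 0 := NeZero.ne _
  have hdet : ((extendedMatrix L)ᵀ * extendedMatrix L).det ≠ 0 := by
    rw [det_transpose_extendedMatrix_mul_self]
    have := (det_transpose_gradMatrix_mul_self_pos (L := L)).ne'
    positivity
  intro u v h
  apply mulVec_injective_of_det_ne_zero hdet
  simp only [← mulVec_mulVec]
  exact congrArg _ h

/-- The bijection sending an edge to the edge of the dual torus crossing it. -/
def dualEdge (L : ℕ) : Edge L ≃ Edge L where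
  toFun b := if b.2 then (b.1 - (0, 1), false) else (b.1 - (1, 0), true)
  invFun b := if b.2 then (b.1 + (1, 0), false) else (b.1 + (0, 1), true)
  left_inv := by rintro ⟨x, _ | _⟩ <;> simp
  right_inv := by rintro ⟨x, _ | _⟩ <;> simp

theorem dualWeights_dualEdge (κ : Edge L → ℝ) (b : Edge L) :
    dualWeights L κ (dualEdge L b) = (κ b)⁻¹ := by
  obtain ⟨x, _ | _⟩ := b <;> simp [dualWeights, dualEdge]

/-- The extended fields, rotated by a quarter turn. -/
def rotatedMatrix (L : ℕ) [NeZero L] :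
    Matrix (Edge L) ({x : Torus L // x ≠ 0} ⊕ Fin 2) ℝ :=
  Matrix.of fun b j => (if b.2 then 1 else -1) * extendedMatrix L (dualEdge L b) j

theorem transpose_rotatedMatrix_mul_gradMatrix :
    (rotatedMatrix L)ᵀ * gradMatrix L = 0 := by
  ext i j
  simp only [Matrix.mul_apply, transpose_apply, gradMatrix_apply, sum_edge, Matrix.zero_apply, rotatedMatrix, of_apply, if_true, if_false, Bool.false_eq_true,
    dualEdge, Equiv.coe_fn_mk, one_mul, neg_mul, Finset.sum_neg_distrib]
  rcases i with i | i
  · simp only [extendedMatrix, fromCols_apply_inl, gradMatrix_apply]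
    rw [← sub_eq_add_neg, ← Finset.sum_sub_distrib]
    exact sum_grad_curl_eq_zero _ _
  · simp only [extendedMatrix, fromCols_apply_inr, harmonicMatrix, of_apply, if_true, if_false,
      Bool.false_eq_true, ← Finset.mul_sum, sum_grad_eq_zero, mul_zero, add_zero, neg_zero]

theorem transpose_rotatedMatrix_mul_diagonal_mul (w : Edge L → ℝ) :
    (rotatedMatrix L)ᵀ * diagonal (fun b => w (dualEdge L b)) * rotatedMatrix L =
      (extendedMatrix L)ᵀ * diagonal w * extendedMatrix L := by
  ext i j
  rw [Matrix.mul_apply, Matrix.mul_apply]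
  simp only [mul_diagonal, transpose_apply]
  rw [← Equiv.sum_comp (dualEdge L)
    (fun b => extendedMatrix L b i * w b * extendedMatrix L b j)]
  refine Finset.sum_congr rfl fun b _ => ?_
  obtain ⟨x, _ | _⟩ := b <;> simp [rotatedMatrix]

theorem card_nonzero_add_one : Fintype.card {x : Torus L // x ≠ 0} + 1 = L * L := by
  have h := Fintype.card_subtype_compl (fun x : Torus L => x = 0)
  have h0 : 0 < L := Nat.pos_of_ne_zero (NeZero.ne L)
  rw [Fintype.card_subtype_eq, Fintype.card_prod, ZMod.card] at h
  have : 0 < L * L := by positivity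
  change Fintype.card {x : Torus L // ¬ x = 0} + 1 = L * L
  omega

theorem det_dual_gram {κ : Edge L → ℝ} (hκ : ∀ b, 0 < κ b) :
    (∏ b, κ b) * ((extendedMatrix L)ᵀ * diagonal (dualWeights L κ) * extendedMatrix L).det =
      ((gradMatrix L)ᵀ * diagonal κ * gradMatrix L).det * (((L : ℝ) ^ 2)⁻¹) ^ 2 := by
  have hcard : Fintype.card (Edge L) =
      Fintype.card ({x : Torus L // x ≠ 0} ⊕ ({x : Torus L // x ≠ 0} ⊕ Fin 2)) := by
    have := card_nonzero_add_one (L := L)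
    simp only [Fintype.card_sum, Fintype.card_fin, Fintype.card_prod, ZMod.card, Fintype.card_bool]
    omega
  have h := prod_mul_det_gram_of_orthogonal (Fintype.equivOfCardEq hcard)
    (transpose_rotatedMatrix_mul_gradMatrix (L := L)) (w := κ) fun b => (hκ b).ne'
  have h1 := transpose_rotatedMatrix_mul_diagonal_mul (dualWeights L κ)
  have h2 := transpose_rotatedMatrix_mul_diagonal_mul (fun _ : Edge L => (1 : ℝ))
  simp only [dualWeights_dualEdge] at h1
  simp only [diagonal_one, Matrix.mul_one] at h2
  rw [h1, h2, det_transpose_extendedMatrix_mul_self] at h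
  apply mul_left_cancel₀ (det_transpose_gradMatrix_mul_self_pos (L := L)).ne'
  linarith

theorem measurable_grad : Measurable fun φ : Torus L → ℝ => grad φ :=
  (gradLinear L).continuous_of_finiteDimensional.measurable

theorem nuL_eq_map : nuL L = Measure.map (gradMatrix L).mulVec volume := by
  have hz : Measurable (zeroExtend L) :=
    (zeroExtend L).continuous_of_finiteDimensional.measurable
  rw [nuL]
  refine (Measure.map_map measurable_grad hz).trans ?_
  congr 1
  ext ψ : 1
  exact (gradMatrix_mulVec ψ).symm

theorem measurable_mulVec {m ι : Type*} [Fintype m] [Fintype ι] (A : Matrix m ι ℝ) :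
    Measurable A.mulVec :=
  A.mulVecLin.continuous_of_finiteDimensional.measurable

theorem nuStar_eq_map : nuStar L = Measure.map (extendedMatrix L).mulVec volume := by
  have hshift : Measurable (fun q : (Edge L → ℝ) × (ℝ × ℝ) => fun b : Edge L =>
      q.1 b + (if b.2 then q.2.1 else q.2.2) / (L : ℝ) ^ 2) := by
    refine measurable_pi_lambda _ ?_
    rintro ⟨x, _ | _⟩ <;> simp <;> fun_prop
  have hG := measurable_mulVec (gradMatrix L)
  have hfin := volume_preserving_finTwoArrow ℝ
  have hsum := volume_measurePreserving_sumPiEquivProdPi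
    (fun _ : {x : Torus L // x ≠ 0} ⊕ Fin 2 => ℝ)
  rw [nuStar, nuL_eq_map, ← hfin.map_eq]
  rw [Measure.map_prod_map _ _ hG hfin.measurable,
    Measure.map_map hshift (hG.prodMap hfin.measurable)]
  change Measure.map _ (volume : Measure (({x : Torus L // x ≠ 0} → ℝ) × (Fin 2 → ℝ))) = _
  rw [← hsum.map_eq, Measure.map_map (hshift.comp (hG.prodMap hfin.measurable)) hsum.measurable]
  congr 1
  ext u b
  obtain ⟨x, _ | _⟩ := b <;>
  simp [extendedMatrix, mulVec, dotProduct, harmonicMatrix, MeasurableEquiv.sumPiEquivProdPi,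
    Equiv.sumPiEquivProdPi, MeasurableEquiv.finTwoArrow, MeasurableEquiv.piFinTwo] <;> ring

theorem measurable_exp_neg_energy (κ : Edge L → ℝ) :
    Measurable fun η => ENNReal.ofReal (exp (-(energy L κ η))) := by
  unfold energy
  fun_prop

theorem ZL_eq {κ : Edge L → ℝ} (hκ : ∀ b, 0 < κ b) :
    ZL L κ = ENNReal.ofReal (√(2 * π) ^ Fintype.card {x : Torus L // x ≠ 0} /
      √((gradMatrix L)ᵀ * diagonal κ * gradMatrix L).det) := by
  rw [ZL, nuL_eq_map, lintegral_map (measurable_exp_neg_energy κ) (measurable_mulVec _)]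
  exact lintegral_exp_neg_half_sum_mul_mulVec_sq κ _
    (posDef_transpose_mul_diagonal_mul hκ gradMatrix_mulVec_injective)

theorem ZLstar_eq {κ : Edge L → ℝ} (hκ : ∀ b, 0 < κ b) :
    ZLstar L κ = ENNReal.ofReal (√(2 * π) ^ Fintype.card ({x : Torus L // x ≠ 0} ⊕ Fin 2) /
      √((extendedMatrix L)ᵀ * diagonal κ * extendedMatrix L).det) := by
  rw [ZLstar, nuStar_eq_map, lintegral_map (measurable_exp_neg_energy κ) (measurable_mulVec _)]
  exact lintegral_exp_neg_half_sum_mul_mulVec_sq κ _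
    (posDef_transpose_mul_diagonal_mul hκ extendedMatrix_mulVec_injective)

theorem dualWeights_pos {κ : Edge L → ℝ} (hκ : ∀ b, 0 < κ b) (b : Edge L) :
    0 < dualWeights L κ b := by
  rw [← (dualEdge L).apply_symm_apply b, dualWeights_dualEdge]
  exact inv_pos.mpr (hκ _)

end Lattice

/-- duality for inhomogeneous Gaussian partition functions:
`Z*_{L,(κ*_b)} = 2πL² (∏_b √κ_b) Z_{L,(κ_b)}`. -/
theorem duality_partition_function (L : ℕ) [NeZero L] (hL : Even L)
    (hL0 : 0 < L) (κ : Edge L → ℝ) (hκ : ∀ b, 0 < κ b) :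
    ZLstar L (dualWeights L κ) =
      ENNReal.ofReal (2 * π * (L : ℝ) ^ 2 * ∏ b : Edge L, Real.sqrt (κ b)) *
        ZL L κ := by
  have hL' : (0 : ℝ) < L := Nat.cast_pos.mpr hL0
  have hdet := det_dual_gram hκ
  have hS := (posDef_transpose_mul_diagonal_mul hκ (gradMatrix_mulVec_injective (L := L))).det_pos
  have hS' := (posDef_transpose_mul_diagonal_mul (dualWeights_pos hκ)
    (extendedMatrix_mulVec_injective (L := L))).det_pos
  have hprod : 0 < ∏ b, κ b := Finset.prod_pos fun b _ => hκ b
  have hsqrt : ∏ b, √(κ b) = √(∏ b, κ b) := (sqrt_prod _ fun b _ => (hκ b).le).symm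
  rw [ZLstar_eq (dualWeights_pos hκ), ZL_eq hκ, ← ENNReal.ofReal_mul (by positivity), hsqrt,
    Fintype.card_sum, Fintype.card_fin, pow_add, sq_sqrt (by positivity)]
  congr 1
  have h := congrArg sqrt hdet
  rw [sqrt_mul hprod.le, sqrt_mul hS.le, sqrt_sq (by positivity)] at h
  have h1 := sqrt_pos.mpr hS
  have h2 := sqrt_pos.mpr hS'
  field_simp at h ⊢
  linear_combination (-1 : ℝ) * h

end
end
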